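/- arXiv:2604.07104 — 2 statements merged into one kernel-verified Lean document; each statement's English description precedes it below -/
import Mathlib

section
/- Let r ≥ 1 and δ ≥ 1 be integers, and let H be an r-uniform hypergraph with δ*(H) = δ. Then for all n ≥ |V(H)|, wsat(n, H) ≥ (δ/r − 1/C(r+δ−1, r−1)) · C(n, r−1). -/
open Finset

/-- `e` belongs to a copy of `H` inside `G`. -/
def IsCopyAt {α β : Type*} [DecidableEq α] [DecidableEq β]
    (H : Finset (Finset α)) (G : Finset (Finset β)) (e : Finset β) : Prop :=
  ∃ f : α ↪ β, (∀ d ∈ H, d.image f ∈ G) ∧ ∃ d ∈ H, d.image f = e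

/-- `F` is weakly `H`-saturated in the complete `r`-uniform hypergraph on `β`. -/
def WSat {α β : Type*} [DecidableEq α] [DecidableEq β] [Fintype β]
    (r : ℕ) (H : Finset (Finset α)) (F : Finset (Finset β)) : Prop :=
  ∃ l : List (Finset β), l.Nodup ∧
    (∀ e : Finset β, e ∈ l ↔ (e.card = r ∧ e ∉ F)) ∧
    ∀ i : Fin l.length, IsCopyAt H (F ∪ (l.take (i + 1)).toFinset) (l.get i)

/-- The weak saturation number of `H` on `n` vertices. -/
noncomputable def wsatNum {α : Type*} [DecidableEq α]
    (r n : ℕ) (H : Finset (Finset α)) : ℕ :=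
  sInf {m | ∃ F : Finset (Finset (Fin n)),
    (∀ e ∈ F, e.card = r) ∧ WSat r H F ∧ F.card = m}

/-- The minimum positive codegree `δ*(H)` of an `r`-uniform hypergraph. -/
noncomputable def minPosCodeg {α : Type*} [DecidableEq α]
    (r : ℕ) (H : Finset (Finset α)) : ℕ :=
  sInf {d | d ≠ 0 ∧ ∃ U : Finset α, U.card = r - 1 ∧
    (H.filter fun e => U ⊆ e).card = d}


lemma key_aux {β : Type*} [DecidableEq β] (δ : ℕ) (hδ : 1 ≤ δ) (k : ℕ) :
    ∀ S E : Finset (Finset β), (∀ U ∈ S, U.card = k) → (∀ e ∈ E, e.card = k + 1) →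
      S.Nonempty → (∀ U ∈ S, δ ≤ (E.filter fun e => U ⊆ e).card) →
      ((δ : ℝ) / ((k + 1 : ℕ) : ℝ) - 1 / ((k + δ).choose k : ℝ)) * (S.card : ℝ) + 1
        ≤ (E.card : ℝ) := by
  induction k with
  | zero =>
    intro S E hS hE hne hdeg
    obtain ⟨U, hU⟩ := hne
    have hS1 : S = {∅} := by
      apply Finset.eq_singleton_iff_unique_mem.2
      have h0 : ∀ x ∈ S, x = ∅ := fun x hx => Finset.card_eq_zero.1 (hS x hx)
      exact ⟨h0 U hU ▸ hU, h0⟩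
    have h1 := (hdeg U hU).trans (Finset.card_filter_le _ _)
    have h2 : (δ : ℝ) ≤ E.card := by exact_mod_cast h1
    subst hS1
    simpa using h2
  | succ k ih =>
    intro S E hS hE hne hdeg
    have hMpos : 0 < (k + 1 + δ).choose (k + 1) := Nat.choose_pos (by omega)
    have hM'pos : 0 < (k + δ).choose k := Nat.choose_pos (by omega)
    have hMM : (k + 1 + δ) * (k + δ).choose k = (k + 1 + δ).choose (k + 1) * (k + 1) := by
      have := Nat.add_one_mul_choose_eq (k + δ) k
      rw [show k + 1 + δ = k + δ + 1 by omega]; exact this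
    generalize hM : (k + 1 + δ).choose (k + 1) = M at *
    generalize hM' : (k + δ).choose k = M' at *
    have hMr : (0 : ℝ) < M := by exact_mod_cast hMpos
    have hM'r : (0 : ℝ) < M' := by exact_mod_cast hM'pos
    have hMMr : ((k : ℝ) + 1 + δ) * M' = M * (k + 1) := by exact_mod_cast hMM
    have hk : (0 : ℝ) < (k : ℝ) + 2 := by positivity
    have hk1 : (0 : ℝ) < (k : ℝ) + 1 := by positivity
    rcases le_or_gt M S.card with hs | hs
    · have hdc : S.card * δ ≤ E.card * (k + 2) := by
        apply Finset.card_mul_le_card_mul (fun U e => U ⊆ e)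
        · intro U hU; exact hdeg U hU
        · intro e he
          calc _ ≤ (powersetCard (k + 1) e).card := by
                apply Finset.card_le_card
                intro U hU
                simp only [Finset.bipartiteBelow, Finset.mem_filter] at hU
                exact Finset.mem_powersetCard.2 ⟨hU.2, hS U hU.1⟩
            _ = k + 2 := by
                rw [Finset.card_powersetCard, hE e he]
                exact Nat.choose_succ_self_right (k + 1)
      have hdr : (S.card : ℝ) * δ ≤ E.card * (k + 2) := by exact_mod_cast hdc
      have hsr : (M : ℝ) ≤ S.card := by exact_mod_cast hs
      have h1 : 1 ≤ 1 / (M : ℝ) * S.card := by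
        rw [one_div, inv_mul_eq_div, le_div_iff₀ hMr]; linarith
      have h2 : (δ : ℝ) / (k + 2) * S.card ≤ E.card := by
        rw [div_mul_eq_mul_div, div_le_iff₀ hk]; linarith
      have h3 : (((k + 1 + 1 : ℕ) : ℝ)) = (k : ℝ) + 2 := by push_cast; ring
      rw [h3]
      linarith
    · set V := E.biUnion id with hV
      have hEV : ∀ e ∈ E, e ⊆ V := fun e he => Finset.subset_biUnion_of_mem id he
      have hSV : ∀ U ∈ S, U ⊆ V := by
        intro U hU
        have : (E.filter fun e => U ⊆ e).Nonempty :=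
          Finset.card_pos.1 (lt_of_lt_of_le hδ (hdeg U hU))
        obtain ⟨e, he⟩ := this
        rw [Finset.mem_filter] at he
        exact he.2.trans (hEV e he.1)
      have hcount : ∀ (T : Finset (Finset β)) (m : ℕ), (∀ e ∈ T, e ⊆ V) → (∀ e ∈ T, e.card = m) →
          ∑ v ∈ V, (T.filter fun e => v ∈ e).card = m * T.card := by
        intro T m hT hm
        have := Finset.sum_card_bipartiteAbove_eq_sum_card_bipartiteBelow
          (s := V) (t := T) (fun v e => v ∈ e)
        simp only [Finset.bipartiteAbove, Finset.bipartiteBelow] at this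
        rw [this, Finset.sum_const_nat (m := m), mul_comm]
        intro e he
        rw [Finset.filter_mem_eq_inter, Finset.inter_eq_right.2 (hT e he), hm e he]
      have hcE := hcount E (k + 2) hEV hE
      have hcS := hcount S (k + 1) hSV hS
      have hVcard : k + 1 + δ ≤ V.card := by
        obtain ⟨U, hU⟩ := hne
        have h1 : (E.filter fun e => U ⊆ e).card ≤ (V \ U).card := by
          have : (E.filter fun e => U ⊆ e) ⊆ (V \ U).image (fun v => insert v U) := by
            intro e he
            rw [Finset.mem_filter] at he
            have hc : (e \ U).card = 1 := by
              rw [Finset.card_sdiff_of_subset he.2, hE e he.1, hS U hU]; omega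
            obtain ⟨v, hv⟩ := Finset.card_eq_one.1 hc
            have hv' : v ∈ e \ U := by rw [hv]; simp
            rw [Finset.mem_sdiff] at hv'
            rw [Finset.mem_image]
            refine ⟨v, Finset.mem_sdiff.2 ⟨hEV e he.1 hv'.1, hv'.2⟩, ?_⟩
            rw [Finset.insert_eq, ← hv, Finset.sdiff_union_of_subset he.2]
          exact (Finset.card_le_card this).trans Finset.card_image_le
        rw [Finset.card_sdiff_of_subset (hSV U hU), hS U hU] at h1
        have h2 := Finset.card_le_card (hSV U hU)
        rw [hS U hU] at h2
        have := hdeg U hU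
        omega
      have hv : ∀ v ∈ V, ((δ : ℝ) / ((k + 1 : ℕ) : ℝ) - 1 / (M' : ℝ)) *
          ((S.filter fun e => v ∈ e).card : ℝ) + 1 ≤ ((E.filter fun e => v ∈ e).card : ℝ) := by
        intro v hvV
        have himg : ∀ T : Finset (Finset β),
            ((T.filter fun e => v ∈ e).image fun e => e.erase v).card
              = (T.filter fun e => v ∈ e).card := by
          intro T
          apply Finset.card_image_of_injOn
          intro a ha b hb hab
          simp only [Finset.coe_filter, Set.mem_ofPred_eq] at ha hb
          have := congrArg (insert v) hab
          simpa [Finset.insert_erase ha.2, Finset.insert_erase hb.2] using this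
        rcases (S.filter fun e => v ∈ e).eq_empty_or_nonempty with h0 | h0
        · rw [h0]
          have : 0 < (E.filter fun e => v ∈ e).card := by
            apply Finset.card_pos.2
            rw [hV, Finset.mem_biUnion] at hvV
            obtain ⟨e, he, hve⟩ := hvV
            exact ⟨e, Finset.mem_filter.2 ⟨he, hve⟩⟩
          have : (1 : ℝ) ≤ (E.filter fun e => v ∈ e).card := by exact_mod_cast this
          simpa using this
        · have := ih ((S.filter fun e => v ∈ e).image fun e => e.erase v)
            ((E.filter fun e => v ∈ e).image fun e => e.erase v) ?_ ?_ (h0.image _) ?_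
          · rw [himg, himg] at this
            exact this
          · intro U hU
            obtain ⟨e, he, rfl⟩ := Finset.mem_image.1 hU
            rw [Finset.mem_filter] at he
            rw [Finset.card_erase_of_mem he.2, hS e he.1]; rfl
          · intro U hU
            obtain ⟨e, he, rfl⟩ := Finset.mem_image.1 hU
            rw [Finset.mem_filter] at he
            rw [Finset.card_erase_of_mem he.2, hE e he.1]; rfl
          · intro U hU
            obtain ⟨W, hW, rfl⟩ := Finset.mem_image.1 hU
            rw [Finset.mem_filter] at hW
            refine (hdeg W hW.1).trans ?_
            apply Finset.card_le_card_of_injOn (fun e => e.erase v)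
            · intro e he
              simp only [Finset.coe_filter, Set.mem_ofPred_eq] at he ⊢
              exact ⟨Finset.mem_image.2 ⟨e, Finset.mem_filter.2 ⟨he.1, he.2 hW.2⟩, rfl⟩,
                Finset.erase_subset_erase v he.2⟩
            · intro a ha b hb hab
              simp only [Finset.coe_filter, Set.mem_ofPred_eq] at ha hb
              have := congrArg (insert v) hab
              simpa [Finset.insert_erase (ha.2 hW.2), Finset.insert_erase (hb.2 hW.2)] using this
      have hsum := Finset.sum_le_sum hv
      rw [Finset.sum_add_distrib, ← Finset.mul_sum, ← Nat.cast_sum, ← Nat.cast_sum, hcE, hcS] at hsum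
      simp only [Finset.sum_const, nsmul_eq_mul, mul_one] at hsum
      have hVr : (k : ℝ) + 1 + δ ≤ V.card := by exact_mod_cast hVcard
      have hsr : (S.card : ℝ) ≤ M := by exact_mod_cast hs.le
      have hδr : (1 : ℝ) ≤ δ := by exact_mod_cast hδ
      push_cast at hsum
      have e1 : ((δ : ℝ) / (k + 1) - 1 / M') * ((k + 1) * S.card)
          = δ * S.card - (k + 1 + δ) * (S.card / M) := by
        have : (1 : ℝ) / M' * (k + 1) = (k + 1 + δ) / M := by
          field_simp; linarith
        have h2 : (δ : ℝ) / (k + 1) * (k + 1) = δ := by field_simp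
        linear_combination (S.card : ℝ) * h2 - (S.card : ℝ) * this
      rw [e1] at hsum
      have hx : (S.card : ℝ) / M ≤ 1 := by rw [div_le_one hMr]; exact hsr
      have h3 : (((k + 1 + 1 : ℕ) : ℝ)) = (k : ℝ) + 2 := by push_cast; ring
      rw [h3]
      have h4 : ((δ : ℝ) / (k + 2) - 1 / M) * S.card + 1
          = (δ * S.card - (k + 2) * (S.card / M) + (k + 2)) / (k + 2) := by
        field_simp
      rw [h4, div_le_iff₀ hk]
      nlinarith [mul_nonneg (sub_nonneg.2 hδr) (sub_nonneg.2 hx)]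

/-- Edges of `F` all of whose `k`-subsets lie in `P`. -/
def innerE {β : Type*} [DecidableEq β] (k : ℕ) (F P : Finset (Finset β)) : Finset (Finset β) :=
  F.filter fun e => powersetCard k e ⊆ P

lemma copy_step {β : Type*} [DecidableEq β] (δ : ℕ) (hδ : 1 ≤ δ) (k : ℕ)
    (F P L E : Finset (Finset β)) (x : Finset β)
    (hE : ∀ e ∈ E, e.card = k + 1)
    (hdeg : ∀ e ∈ E, ∀ U ∈ powersetCard k e, δ ≤ (E.filter fun e => U ⊆ e).card)
    (hL : ∀ e ∈ L, powersetCard k e ⊆ P)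
    (hEF : ∀ e ∈ E, e ∈ F ∨ e ∈ L ∨ e = x)
    (hP : ((δ : ℝ) / ((k + 1 : ℕ) : ℝ) - 1 / ((k + δ).choose k : ℝ)) * (P.card : ℝ)
        ≤ ((innerE k F P).card : ℝ)) :
    ((δ : ℝ) / ((k + 1 : ℕ) : ℝ) - 1 / ((k + δ).choose k : ℝ)) *
        ((P ∪ E.biUnion (powersetCard k)).card : ℝ)
        ≤ ((innerE k F (P ∪ E.biUnion (powersetCard k))).card : ℝ) := by
  set P' := P ∪ E.biUnion (powersetCard k) with hP'
  have hPP' : P ⊆ P' := Finset.subset_union_left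
  rcases (P' \ P).eq_empty_or_nonempty with h0 | h0
  · have : P' = P := Finset.Subset.antisymm (Finset.sdiff_eq_empty_iff_subset.1 h0) hPP'
    rw [this]; exact hP
  · set E' := E.filter fun e => ¬ powersetCard k e ⊆ P with hE'
    have hmem : ∀ U ∈ P' \ P, ∃ e ∈ E, U ∈ powersetCard k e := by
      intro U hU
      rw [Finset.mem_sdiff, hP', Finset.mem_union] at hU
      exact Finset.mem_biUnion.1 (hU.1.resolve_left hU.2)
    have hkey := key_aux δ hδ k (P' \ P) E' ?_ ?_ h0 ?_
    · have hsub : (innerE k F P) ∪ (E'.erase x) ⊆ innerE k F P' := by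
        intro e he
        rcases Finset.mem_union.1 he with he | he
        · rw [innerE, Finset.mem_filter] at he ⊢
          exact ⟨he.1, he.2.trans hPP'⟩
        · rw [Finset.mem_erase, hE', Finset.mem_filter] at he
          obtain ⟨hx, heE, hns⟩ := he
          rw [innerE, Finset.mem_filter]
          refine ⟨?_, ?_⟩
          · rcases hEF e heE with h | h | h
            · exact h
            · exact absurd (hL e h) hns
            · exact absurd h hx
          · exact (Finset.subset_biUnion_of_mem (powersetCard k) heE).trans
              Finset.subset_union_right
      have hdisj : Disjoint (innerE k F P) (E'.erase x) := by
        rw [Finset.disjoint_left]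
        intro e he he'
        rw [innerE, Finset.mem_filter] at he
        rw [Finset.mem_erase, hE', Finset.mem_filter] at he'
        exact he'.2.2 he.2
      have h1 := Finset.card_le_card hsub
      rw [Finset.card_union_of_disjoint hdisj] at h1
      have h2 := Finset.pred_card_le_card_erase (s := E') (a := x)
      have h3 : (innerE k F P).card + E'.card ≤ (innerE k F P').card + 1 := by omega
      have h4 : ((innerE k F P).card : ℝ) + E'.card ≤ (innerE k F P').card + 1 := by
        exact_mod_cast h3
      have h5 : (P'.card : ℝ) = P.card + (P' \ P).card := by
        have := Finset.card_sdiff_add_card_eq_card hPP'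
        rw [← this]; push_cast; ring
      rw [h5, mul_add]
      linarith
    · intro U hU
      obtain ⟨e, _, h⟩ := hmem U hU
      exact (Finset.mem_powersetCard.1 h).2
    · intro e he
      exact hE e (Finset.mem_filter.1 he).1
    · intro U hU
      obtain ⟨e, he, h⟩ := hmem U hU
      refine (hdeg e he U h).trans (Finset.card_le_card ?_)
      intro d hd
      rw [Finset.mem_filter] at hd
      rw [Finset.mem_filter, hE', Finset.mem_filter]
      refine ⟨⟨hd.1, fun hs => ?_⟩, hd.2⟩
      exact (Finset.mem_sdiff.1 hU).2
        (hs (Finset.mem_powersetCard.2 ⟨hd.2, (Finset.mem_powersetCard.1 h).2⟩))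

lemma wsat_bound {α : Type*} [DecidableEq α] (k δ n : ℕ) (hδ : 1 ≤ δ)
    (H : Finset (Finset α)) (hunif : ∀ e ∈ H, e.card = k + 1)
    (hdegH : ∀ e ∈ H, ∀ U ∈ powersetCard k e, δ ≤ (H.filter fun e => U ⊆ e).card)
    (hn : k + δ ≤ n) (F : Finset (Finset (Fin n)))
    (hW : WSat (k + 1) H F) :
    ((δ : ℝ) / ((k + 1 : ℕ) : ℝ) - 1 / ((k + δ).choose k : ℝ)) * (n.choose k : ℝ)
      ≤ (F.card : ℝ) := by
  obtain ⟨l, -, hl, hcopy⟩ := hW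
  have hinv : ∀ i ≤ l.length, ∃ P : Finset (Finset (Fin n)),
      (∀ U ∈ P, U.card = k) ∧
      ((δ : ℝ) / ((k + 1 : ℕ) : ℝ) - 1 / ((k + δ).choose k : ℝ)) * (P.card : ℝ)
        ≤ ((innerE k F P).card : ℝ) ∧ ∀ e ∈ (l.take i).toFinset, powersetCard k e ⊆ P := by
    intro i
    induction i with
    | zero => intro _; exact ⟨∅, by simp, by simp, by simp⟩
    | succ i ih =>
      intro hi
      obtain ⟨P, hPk, hP, hL⟩ := ih (by omega)
      obtain ⟨f, hf, d₀, hd₀, hd₀e⟩ := hcopy ⟨i, hi⟩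
      have htake : (l.take (i + 1)).toFinset = insert (l.get ⟨i, hi⟩) (l.take i).toFinset := by
        rw [List.take_succ_eq_append_getElem hi]
        ext a
        simp only [List.mem_toFinset, List.mem_append, List.mem_singleton, Finset.mem_insert,
          List.get_eq_getElem]
        exact or_comm
      have hcardE : ∀ e ∈ H.image (fun d => d.image f), e.card = k + 1 := by
        intro e he
        obtain ⟨d, hd, rfl⟩ := Finset.mem_image.1 he
        rw [Finset.card_image_of_injective _ f.injective, hunif d hd]
      have hstep := copy_step δ hδ k F P (l.take i).toFinset (H.image (fun d => d.image f))
          (l.get ⟨i, hi⟩) hcardE ?_ hL ?_ hP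
      refine ⟨_, ?_, hstep, ?_⟩
      · intro U hU
        rcases Finset.mem_union.1 hU with h | h
        · exact hPk U h
        · obtain ⟨e, _, h⟩ := Finset.mem_biUnion.1 h
          exact (Finset.mem_powersetCard.1 h).2
      · intro e he
        rw [htake, Finset.mem_insert] at he
        rcases he with rfl | he
        · refine subset_trans ?_ Finset.subset_union_right
          apply Finset.subset_biUnion_of_mem (powersetCard k)
          rw [← hd₀e]
          exact Finset.mem_image_of_mem _ hd₀
        · exact (hL e he).trans Finset.subset_union_left
      · intro e he U hU
        obtain ⟨d, hd, rfl⟩ := Finset.mem_image.1 he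
        rw [Finset.mem_powersetCard] at hU
        obtain ⟨W, hWd, rfl⟩ := Finset.subset_image_iff.1 hU.1
        have hWk : W.card = k := by
          rw [← hU.2, Finset.card_image_of_injective _ f.injective]
        refine (hdegH d hd W (Finset.mem_powersetCard.2 ⟨by exact_mod_cast hWd, hWk⟩)).trans ?_
        apply Finset.card_le_card_of_injOn (fun e => e.image f)
        · intro e he
          simp only [Finset.coe_filter, Set.mem_ofPred_eq] at he ⊢
          exact ⟨Finset.mem_image_of_mem _ he.1, Finset.image_subset_image he.2⟩
        · exact (Finset.image_injective f.injective).injOn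
      · intro e he
        obtain ⟨d, hd, rfl⟩ := Finset.mem_image.1 he
        have := hf d hd
        change d.image f ∈ F ∪ (l.take (i + 1)).toFinset at this
        rw [htake, Finset.mem_union, Finset.mem_insert] at this
        tauto
  obtain ⟨P, hPk, hP, hL⟩ := hinv l.length le_rfl
  rw [List.take_length] at hL
  have hsubP : P ⊆ powersetCard k (univ : Finset (Fin n)) := fun U hU =>
    Finset.mem_powersetCard.2 ⟨Finset.subset_univ _, hPk U hU⟩
  have hall : (powersetCard k (univ : Finset (Fin n))).card = n.choose k := by simp
  have hfin := copy_step δ hδ k F P l.toFinset (powersetCard (k + 1) (univ : Finset (Fin n))) ∅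
    (fun e he => (Finset.mem_powersetCard.1 he).2) ?_ hL ?_ hP
  · have heq : P ∪ (powersetCard (k + 1) (univ : Finset (Fin n))).biUnion (powersetCard k)
        = powersetCard k univ := by
      apply Finset.Subset.antisymm
      · apply Finset.union_subset hsubP
        intro U hU
        obtain ⟨e, _, h⟩ := Finset.mem_biUnion.1 hU
        exact Finset.mem_powersetCard.2 ⟨Finset.subset_univ _, (Finset.mem_powersetCard.1 h).2⟩
      · intro U hU
        have hUk := (Finset.mem_powersetCard.1 hU).2
        obtain ⟨e, hUe, he⟩ := Finset.exists_superset_card_eq (s := U) (n := k + 1)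
          (by omega) (by simp; omega)
        apply Finset.mem_union_right
        exact Finset.mem_biUnion.2 ⟨e, Finset.mem_powersetCard.2 ⟨Finset.subset_univ _, he⟩,
          Finset.mem_powersetCard.2 ⟨hUe, hUk⟩⟩
    rw [heq, hall] at hfin
    refine hfin.trans ?_
    exact_mod_cast Finset.card_filter_le _ _
  · intro e _ U hU
    have hUk := (Finset.mem_powersetCard.1 hU).2
    have h1 : (Uᶜ).card = n - k := by rw [Finset.card_compl, hUk]; simp
    have h2 : (Uᶜ).card ≤
        ((powersetCard (k + 1) (univ : Finset (Fin n))).filter fun e => U ⊆ e).card := by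
      apply Finset.card_le_card_of_injOn (fun v => insert v U)
      · intro v hv
        have hv : v ∉ U := by simpa using hv
        simp only [Finset.coe_filter, Set.mem_ofPred_eq]
        refine ⟨Finset.mem_powersetCard.2 ⟨Finset.subset_univ _, ?_⟩, Finset.subset_insert _ _⟩
        rw [Finset.card_insert_of_notMem hv, hUk]
      · intro v hv w hw h
        have hv : v ∉ U := by simpa using hv
        have hm : v ∈ insert w U := by
          have : v ∈ insert v U := Finset.mem_insert_self _ _
          rwa [show insert v U = insert w U from h] at this
        exact (Finset.mem_insert.1 hm).resolve_right hv
    omega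
  · intro e he
    by_cases h : e ∈ F
    · exact Or.inl h
    · exact Or.inr (Or.inl (List.mem_toFinset.2
        ((hl e).2 ⟨(Finset.mem_powersetCard.1 he).2, h⟩)))

theorem wsat_lower_bound_via_delta_star {α : Type*} [DecidableEq α]
    (r δ n : ℕ) (hr : 1 ≤ r) (hδ : 1 ≤ δ)
    (H : Finset (Finset α)) (hne : H.Nonempty)
    (hunif : ∀ e ∈ H, e.card = r)
    (hstar : minPosCodeg r H = δ)
    (hn : (H.sup id).card ≤ n) :
    ((δ : ℝ) / r - 1 / (r + δ - 1).choose (r - 1)) * n.choose (r - 1) ≤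
      wsatNum r n H := by
  obtain ⟨k, rfl⟩ : ∃ k, r = k + 1 := ⟨r - 1, by omega⟩
  have hdegH : ∀ e ∈ H, ∀ U ∈ powersetCard k e, δ ≤ (H.filter fun e => U ⊆ e).card := by
    intro e he U hU
    rw [Finset.mem_powersetCard] at hU
    rw [← hstar]
    apply Nat.sInf_le
    refine ⟨?_, U, by simpa using hU.2, rfl⟩
    exact Finset.card_ne_zero_of_mem (Finset.mem_filter.2 ⟨he, hU.1⟩)
  have hkn : k + δ ≤ n := by
    obtain ⟨e, he⟩ := hne
    obtain ⟨U, hUe, hUk⟩ := Finset.exists_subset_card_eq (s := e) (n := k)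
      (by rw [hunif e he]; omega)
    have hsup : ∀ d ∈ H, d ⊆ H.sup id := fun d hd => Finset.le_sup (f := id) hd
    have h1 : (H.filter fun e => U ⊆ e).card ≤ (H.sup id \ U).card := by
      have : (H.filter fun e => U ⊆ e) ⊆ (H.sup id \ U).image (fun v => insert v U) := by
        intro d hd
        rw [Finset.mem_filter] at hd
        have hc : (d \ U).card = 1 := by
          rw [Finset.card_sdiff_of_subset hd.2, hunif d hd.1, hUk]; omega
        obtain ⟨v, hv⟩ := Finset.card_eq_one.1 hc
        have hv' : v ∈ d \ U := by rw [hv]; simp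
        rw [Finset.mem_sdiff] at hv'
        rw [Finset.mem_image]
        refine ⟨v, Finset.mem_sdiff.2 ⟨hsup d hd.1 hv'.1, hv'.2⟩, ?_⟩
        rw [Finset.insert_eq, ← hv, Finset.sdiff_union_of_subset hd.2]
      exact (Finset.card_le_card this).trans Finset.card_image_le
    have hUs := hUe.trans (hsup e he)
    rw [Finset.card_sdiff_of_subset hUs, hUk] at h1
    have h2 := Finset.card_le_card hUs
    have := hdegH e he U (Finset.mem_powersetCard.2 ⟨hUe, hUk⟩)
    omega
  have hmem : wsatNum (k + 1) n H ∈ {m | ∃ F : Finset (Finset (Fin n)),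
      (∀ e ∈ F, e.card = k + 1) ∧ WSat (k + 1) H F ∧ F.card = m} := by
    apply Nat.sInf_mem
    refine ⟨_, powersetCard (k + 1) univ, ?_, ?_, rfl⟩
    · intro e he; exact (Finset.mem_powersetCard.1 he).2
    · refine ⟨[], by simp, ?_, fun i => i.elim0⟩
      intro e
      simp [Finset.mem_powersetCard]
  obtain ⟨F, _, hW, hF⟩ := hmem
  rw [← hF]
  have := wsat_bound k δ n hδ H hunif hdegH hkn F hW
  rw [show k + 1 + δ - 1 = k + δ by omega, show k + 1 - 1 = k by omega]
  exact this
end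

section
/- Let r ≥ 2, s ≥ 2 be integers and H an r-uniform hypergraph with sparseness s(H) = s. Then for all n ≥ |V(H)|, wsat(n, H) ≥ γ_{s,H} · (C(n, s−1) − |∂_{s−1}(H)|) + |E(H)| − 1, where γ_{s,H} = min over nonempty G ⊆ H with |∂_{s−1}(G)| < |∂_{s−1}(H)| of (|E(H)| − |E(G)| − 1)/(|∂_{s−1}(H)| − |∂_{s−1}(G)|). -/
open Finset

/-- The sparseness of a hypergraph. -/
noncomputable def spars {α : Type*} [DecidableEq α] (H : Finset (Finset α)) : ℕ :=
  sInf {m | ∃ S : Finset α, S.card = m ∧ (H.filter fun e => S ⊆ e).card = 1}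

/-- The `m`-shadow of a hypergraph: all `m`-element vertex subsets contained in some edge. -/
def hyperShadow {α : Type*} [DecidableEq α] (m : ℕ) (H : Finset (Finset α)) :
    Finset (Finset α) :=
  H.sup fun e => e.powersetCard m

/-- The quantity `γ_{s,H}`. -/
noncomputable def gammaVal {α : Type*} [DecidableEq α]
    (s : ℕ) (H : Finset (Finset α)) : ℝ :=
  sInf {x : ℝ | ∃ G : Finset (Finset α), G ⊆ H ∧ G.Nonempty ∧
    (hyperShadow (s - 1) G).card < (hyperShadow (s - 1) H).card ∧
    x = ((H.card : ℝ) - G.card - 1) /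
      ((hyperShadow (s - 1) H).card - (hyperShadow (s - 1) G).card)}

lemma mem_hs {β : Type*} [DecidableEq β] {m : ℕ} {H : Finset (Finset β)} {x : Finset β} :
    x ∈ hyperShadow m H ↔ ∃ e ∈ H, x ⊆ e ∧ x.card = m := by
  simp [hyperShadow, Finset.mem_sup, Finset.mem_powersetCard]

lemma hs_mono {β : Type*} [DecidableEq β] {m : ℕ} {G H : Finset (Finset β)} (h : G ⊆ H) :
    hyperShadow m G ⊆ hyperShadow m H := by
  intro x hx
  rw [mem_hs] at *
  obtain ⟨e, he, h2⟩ := hx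
  exact ⟨e, h he, h2⟩

lemma image_inj_on {α β : Type*} [DecidableEq α] [DecidableEq β] {V : Finset α} {g : α → β}
    (hg : Set.InjOn g V) {x y : Finset α} (hx : x ⊆ V) (hy : y ⊆ V)
    (h : x.image g = y.image g) : x = y := by
  have key : ∀ x y : Finset α, x ⊆ V → y ⊆ V → x.image g = y.image g → x ⊆ y := by
    intro x y hx hy h a ha
    have : g a ∈ y.image g := h ▸ mem_image_of_mem g ha
    obtain ⟨b, hb, hab⟩ := mem_image.1 this
    have := hg (hy hb) (hx ha) hab
    exact this ▸ hb
  exact Finset.Subset.antisymm (key x y hx hy h) (key y x hy hx h.symm)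

lemma hs_image_card {α β : Type*} [DecidableEq α] [DecidableEq β] {V : Finset α} {g : α → β}
    (hg : Set.InjOn g V) (m : ℕ) (G : Finset (Finset α)) (hG : ∀ d ∈ G, d ⊆ V) :
    (hyperShadow m (G.image fun d => d.image g)).card = (hyperShadow m G).card := by
  have : hyperShadow m (G.image fun d => d.image g)
      = (hyperShadow m G).image (fun d => d.image g) := by
    ext x
    simp only [mem_hs, mem_image]
    constructor
    · rintro ⟨_, ⟨d, hd, rfl⟩, hx, hc⟩
      obtain ⟨t, ht, rfl⟩ := subset_image_iff.1 hx
      refine ⟨t, ⟨d, hd, by exact_mod_cast ht, ?_⟩, rfl⟩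
      rw [← hc, card_image_of_injOn]
      exact hg.mono (fun a ha => hG d hd (by exact_mod_cast ht ha))
    · rintro ⟨t, ⟨d, hd, ht, hc⟩, rfl⟩
      refine ⟨_, ⟨d, hd, rfl⟩, image_subset_image ht, ?_⟩
      rw [← hc, card_image_of_injOn]
      exact hg.mono (fun a ha => hG d hd (ht ha))
  rw [this, card_image_of_injOn]
  intro x hx y hy h
  obtain ⟨d, hd, hxd, -⟩ := mem_hs.1 hx
  obtain ⟨d', hd', hyd, -⟩ := mem_hs.1 hy
  exact image_inj_on hg (hxd.trans (hG d hd)) (hyd.trans (hG d' hd')) h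

lemma sub_V {α : Type*} [DecidableEq α] {H : Finset (Finset α)} {d} (hd : d ∈ H) :
    d ⊆ H.sup id := Finset.le_sup (f := id) hd

lemma gammaSet_nonneg {α : Type*} [DecidableEq α] (s : ℕ) (H : Finset (Finset α)) :
    ∀ x ∈ {x : ℝ | ∃ G : Finset (Finset α), G ⊆ H ∧ G.Nonempty ∧
    (hyperShadow (s - 1) G).card < (hyperShadow (s - 1) H).card ∧
    x = ((H.card : ℝ) - G.card - 1) /
      ((hyperShadow (s - 1) H).card - (hyperShadow (s - 1) G).card)}, 0 ≤ x := by
  rintro x ⟨G, hG, -, hlt, rfl⟩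
  have h1 : G.card < H.card := by
    apply card_lt_card
    refine lt_of_le_of_ne hG ?_
    rintro rfl
    exact lt_irrefl _ hlt
  have h1' : (G.card : ℝ) + 1 ≤ H.card := by exact_mod_cast h1
  have h2 : ((hyperShadow (s - 1) G).card : ℝ) < (hyperShadow (s - 1) H).card := by
    exact_mod_cast hlt
  apply div_nonneg <;> linarith

lemma gamma_nonneg {α : Type*} [DecidableEq α] (s : ℕ) (H : Finset (Finset α)) :
    0 ≤ gammaVal s H := Real.sInf_nonneg (gammaSet_nonneg s H)

lemma gamma_le {α : Type*} [DecidableEq α] (s : ℕ) (H G : Finset (Finset α))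
    (hG : G ⊆ H) (hne : G.Nonempty) (hn : G ≠ H) :
    gammaVal s H * (((hyperShadow (s - 1) H).card : ℝ) - (hyperShadow (s - 1) G).card) ≤
      (H.card : ℝ) - G.card - 1 := by
  have h1 : G.card < H.card := card_lt_card (lt_of_le_of_ne hG hn)
  have h1' : (G.card : ℝ) + 1 ≤ H.card := by exact_mod_cast h1
  rcases (card_le_card (hs_mono (m := s - 1) hG)).lt_or_eq with h | h
  · have h2 : ((hyperShadow (s - 1) G).card : ℝ) < (hyperShadow (s - 1) H).card := by
      exact_mod_cast h
    rw [← le_div_iff₀ (by linarith)]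
    exact csInf_le ⟨0, fun x hx => gammaSet_nonneg s H x hx⟩ ⟨G, hG, hne, h, rfl⟩
  · rw [h]; linarith

def IsC {α β : Type*} [DecidableEq α] [DecidableEq β]
    (H : Finset (Finset α)) (K : Finset (Finset β)) : Prop :=
  ∃ g : α → β, Set.InjOn g (H.sup id : Finset α) ∧ K = H.image (fun d => d.image g)

lemma IsC.props {α β : Type*} [DecidableEq α] [DecidableEq β] (s : ℕ)
    {H : Finset (Finset α)} {K : Finset (Finset β)} (h : IsC H K) :
    K.card = H.card ∧ (hyperShadow (s - 1) K).card = (hyperShadow (s - 1) H).card ∧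
    ∀ L ⊆ K, L.Nonempty → L ≠ K →
      gammaVal s H * (((hyperShadow (s - 1) K).card : ℝ) - (hyperShadow (s - 1) L).card) ≤
      (K.card : ℝ) - L.card - 1 := by
  obtain ⟨g, hg, rfl⟩ := h
  have hinj : ∀ G ⊆ H, Set.InjOn (fun d : Finset α => d.image g) (G : Set (Finset α)) := by
    intro G hG x hx y hy hxy
    exact image_inj_on hg (sub_V (hG hx)) (sub_V (hG hy)) hxy
  have c1 := card_image_of_injOn (hinj H (Subset.refl _))
  have c2 := hs_image_card hg (s - 1) H (fun d hd => sub_V hd)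
  refine ⟨c1, c2, ?_⟩
  intro L hL hLn hLK
  obtain ⟨G, hG, rfl⟩ := subset_image_iff.1 hL
  have hG : G ⊆ H := by exact_mod_cast hG
  rw [c1, c2, card_image_of_injOn (hinj G hG),
    hs_image_card hg (s - 1) G (fun d hd => sub_V (hG hd))]
  apply gamma_le s H G hG
  · simpa using hLn
  · rintro rfl; exact hLK rfl

def GoodFam {β : Type*} [DecidableEq β] (γ : ℝ) (m a b : ℕ) (F : Finset (Finset β))
    (P : Finset (Finset (Finset β))) : Prop :=
  (∀ C ∈ P, ∀ D ∈ P, C ≠ D → Disjoint C D) ∧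
  ∀ C ∈ P, γ * (((hyperShadow m C).card : ℝ) - a) + b - 1 ≤ ((C ∩ F).card : ℝ)

lemma step {β : Type*} [DecidableEq β] {γ : ℝ} (hγ : 0 ≤ γ) {m a b : ℕ}
    {F : Finset (Finset β)} {P : Finset (Finset (Finset β))} (hP : GoodFam γ m a b F P)
    {K : Finset (Finset β)} (hKb : K.card = b) (hKa : (hyperShadow m K).card = a)
    (hK : ∀ L ⊆ K, L.Nonempty → L ≠ K →
      γ * (((hyperShadow m K).card : ℝ) - (hyperShadow m L).card) ≤ (K.card : ℝ) - L.card - 1)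
    (e : Finset β) (he : ∀ x ∈ K, x ∈ F ∨ x = e ∨ ∃ C ∈ P, x ∈ C) :
    ∃ P', GoodFam γ m a b F P' ∧ (∀ C ∈ P, ∃ C' ∈ P', C ⊆ C') ∧ ∃ C' ∈ P', K ⊆ C' := by
  by_cases hex : ∃ C ∈ P, K ⊆ C
  · exact ⟨P, hP, fun C hC => ⟨C, hC, Subset.refl _⟩, hex⟩
  push Not at hex
  obtain ⟨hdis, hgood⟩ := hP
  set D := P.filter (fun C => (K ∩ C).Nonempty) with hD
  have hDP : D ⊆ P := filter_subset _ _
  set U := D.biUnion id with hU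
  have hUm : ∀ x, x ∈ U ↔ ∃ C ∈ D, x ∈ C := by intro x; simp [hU]
  refine ⟨insert (K ∪ U) (P \ D), ⟨?_, ?_⟩, ?_, ?_⟩
  · have key : ∀ C ∈ P \ D, Disjoint C (K ∪ U) := by
      intro C hC
      obtain ⟨hCP, hCD⟩ := mem_sdiff.1 hC
      rw [disjoint_union_right]
      constructor
      · rw [disjoint_comm, disjoint_iff_inter_eq_empty]
        by_contra hne
        exact hCD (mem_filter.2 ⟨hCP, nonempty_iff_ne_empty.2 hne⟩)
      · rw [hU, disjoint_biUnion_right]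
        intro E hE
        apply hdis C hCP E (hDP hE)
        rintro rfl; exact hCD hE
    intro C hC E hE hne
    rcases mem_insert.1 hC with rfl | hC <;> rcases mem_insert.1 hE with rfl | hE
    · exact absurd rfl hne
    · exact (key E hE).symm
    · exact key C hC
    · exact hdis C (mem_sdiff.1 hC).1 E (mem_sdiff.1 hE).1 hne
  · intro C hC
    rcases mem_insert.1 hC with rfl | hC
    swap
    · exact hgood C (mem_sdiff.1 hC).1
    have pd : (D : Set (Finset (Finset β))).PairwiseDisjoint id := by
      intro C hC E hE hne
      exact hdis C (hDP hC) E (hDP hE) hne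
    -- edges of F
    have h1 : (U ∩ F).card = ∑ C ∈ D, (C ∩ F).card := by
      rw [hU, biUnion_inter, card_biUnion]
      · rfl
      · intro C hC E hE hne
        exact (pd hC hE hne).mono inter_subset_left inter_subset_left
    have h2 : (K ∩ U).card = ∑ C ∈ D, (K ∩ C).card := by
      rw [hU, inter_biUnion, card_biUnion]
      · rfl
      · intro C hC E hE hne
        exact (pd hC hE hne).mono inter_subset_right inter_subset_right
    have h3 : K.card ≤ ((K \ U) ∩ F).card + (K ∩ U).card + 1 := by
      have hsub : K ⊆ (((K \ U) ∩ F) ∪ (K ∩ U)) ∪ {e} := by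
        intro x hx
        by_cases hxU : x ∈ U
        · simp [hx, hxU]
        · rcases he x hx with h | h | ⟨C, hC, hxC⟩
          · simp [hx, hxU, h]
          · simp [h]
          · exact absurd ((hUm x).2 ⟨C, mem_filter.2 ⟨hC, x, mem_inter.2 ⟨hx, hxC⟩⟩, hxC⟩) hxU
      calc K.card ≤ _ := card_le_card hsub
        _ ≤ _ := card_union_le _ _
        _ ≤ _ := by
          have := card_union_le ((K \ U) ∩ F) (K ∩ U)
          simp only [card_singleton]; omega
    have h4 : ((K ∪ U) ∩ F).card = (U ∩ F).card + ((K \ U) ∩ F).card := by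
      rw [← card_union_of_disjoint]
      · congr 1
        ext x; simp only [mem_inter, mem_union, mem_sdiff]; tauto
      · rw [disjoint_left]; intro x; simp only [mem_inter, mem_sdiff]; tauto
    -- shadow
    have h5 : (hyperShadow m (K ∪ U)).card ≤ (hyperShadow m K).card +
        ∑ C ∈ D, ((hyperShadow m C) \ (hyperShadow m (K ∩ C))).card := by
      have hsub : hyperShadow m (K ∪ U) ⊆ hyperShadow m K ∪
          D.biUnion (fun C => (hyperShadow m C) \ (hyperShadow m (K ∩ C))) := by
        intro x hx
        by_cases hxK : x ∈ hyperShadow m K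
        · simp [hxK]
        obtain ⟨f, hf, hxf⟩ := mem_hs.1 hx
        rcases mem_union.1 hf with hf | hf
        · exact absurd (mem_hs.2 ⟨f, hf, hxf⟩) hxK
        · obtain ⟨C, hC, hfC⟩ := (hUm f).1 hf
          refine mem_union_right _ (mem_biUnion.2 ⟨C, hC, mem_sdiff.2 ⟨mem_hs.2 ⟨f, hfC, hxf⟩, ?_⟩⟩)
          intro h
          exact hxK (hs_mono inter_subset_left h)
      refine (card_le_card hsub).trans ((card_union_le _ _).trans ?_)
      exact Nat.add_le_add_left card_biUnion_le _
    have h5' : ((hyperShadow m (K ∪ U)).card : ℝ) ≤ (hyperShadow m K).card +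
        ∑ C ∈ D, (((hyperShadow m C).card : ℝ) - (hyperShadow m (K ∩ C)).card) := by
      have : ∀ C ∈ D, (((hyperShadow m C).card : ℝ) - (hyperShadow m (K ∩ C)).card)
          = (((hyperShadow m C) \ (hyperShadow m (K ∩ C))).card : ℝ) := by
        intro C hC
        rw [cast_card_sdiff (hs_mono inter_subset_right)]
      rw [sum_congr rfl this]
      exact_mod_cast h5
    have h6 : ∑ C ∈ D, (γ * (((hyperShadow m C).card : ℝ) - (hyperShadow m (K ∩ C)).card))
        ≤ ∑ C ∈ D, (((C ∩ F).card : ℝ) - (K ∩ C).card) := by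
      apply sum_le_sum
      intro C hC
      have g1 := hgood C (hDP hC)
      have g2 := hK (K ∩ C) inter_subset_left (mem_filter.1 hC).2 (by
        intro h
        exact hex C (hDP hC) (h ▸ inter_subset_right))
      rw [hKa, hKb] at g2
      linarith
    rw [sum_sub_distrib, ← mul_sum] at h6
    have h7 := mul_le_mul_of_nonneg_left h5' hγ
    rw [hKa] at h7
    rw [mul_add] at h7
    have h1' : ((U ∩ F).card : ℝ) = ∑ C ∈ D, ((C ∩ F).card : ℝ) := by exact_mod_cast h1
    have h2' : ((K ∩ U).card : ℝ) = ∑ C ∈ D, ((K ∩ C).card : ℝ) := by exact_mod_cast h2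
    have h3' : (b : ℝ) ≤ ((K \ U) ∩ F).card + (K ∩ U).card + 1 := by
      rw [← hKb]; exact_mod_cast h3
    have h4' : (((K ∪ U) ∩ F).card : ℝ) = (U ∩ F).card + ((K \ U) ∩ F).card := by
      exact_mod_cast h4
    rw [mul_sub]
    linarith
  · intro C hC
    by_cases hCD : C ∈ D
    · exact ⟨K ∪ U, mem_insert_self _ _, fun x hx => mem_union_right _ ((hUm x).2 ⟨C, hCD, hx⟩)⟩
    · exact ⟨C, mem_insert_of_mem (mem_sdiff.2 ⟨hC, hCD⟩), Subset.refl _⟩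
  · exact ⟨K ∪ U, mem_insert_self _ _, subset_union_left⟩

lemma exists_perm_image {β : Type*} [DecidableEq β] [Fintype β] {S T : Finset β}
    (h : S.card = T.card) : ∃ σ : Equiv.Perm β, S.image σ = T := by
  let e : {x // x ∈ S} ≃ {x // x ∈ T} := Finset.equivOfCardEq h
  refine ⟨e.extendSubtype, ?_⟩
  apply eq_of_subset_of_card_le
  · intro y hy
    obtain ⟨x, hx, rfl⟩ := mem_image.1 hy
    exact e.extendSubtype_mem x hx
  · rw [card_image_of_injective _ (Equiv.injective _), h]

lemma swap_image_of_iff {β : Type*} [DecidableEq β] {S : Finset β} {u v : β}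
    (h : u ∈ S ↔ v ∈ S) : S.image (Equiv.swap u v) = S := by
  apply eq_of_subset_of_card_le
  · intro y hy
    obtain ⟨x, hx, rfl⟩ := mem_image.1 hy
    rw [Equiv.swap_apply_def]
    split_ifs with h1 h2
    · subst h1; exact h.1 hx
    · subst h2; exact h.2 hx
    · exact hx
  · rw [card_image_of_injective _ (Equiv.injective _)]

lemma exists_perm_image2 {β : Type*} [DecidableEq β] [Fintype β] {S T : Finset β}
    (h : S.card = T.card) {a b u v : β} (ha : a ∈ S) (hb : b ∉ S) (hu : u ∈ T) (hv : v ∉ T) :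
    ∃ σ : Equiv.Perm β, S.image σ = T ∧ σ a = u ∧ σ b = v := by
  obtain ⟨σ, hσ⟩ := exists_perm_image h
  have h1 : σ a ∈ T := hσ ▸ mem_image_of_mem _ ha
  have h2 : σ b ∉ T := by
    rw [← hσ]; simpa using hb
  refine ⟨(σ.trans (Equiv.swap (σ a) u)).trans (Equiv.swap (σ b) v), ?_, ?_, ?_⟩
  · have : S.image ((σ.trans (Equiv.swap (σ a) u)).trans (Equiv.swap (σ b) v))
      = ((S.image σ).image (Equiv.swap (σ a) u)).image (Equiv.swap (σ b) v) := by
      simp only [image_image]; rfl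
    have e1 : T.image (Equiv.swap (σ a) u) = T := swap_image_of_iff (by tauto)
    rw [this, hσ, e1, swap_image_of_iff (by tauto)]
  · simp only [Equiv.trans_apply, Equiv.swap_apply_left]
    apply Equiv.swap_apply_of_ne_of_ne
    · rintro rfl; exact h2 hu
    · rintro rfl; exact hv hu
  · simp only [Equiv.trans_apply]
    rw [Equiv.swap_apply_of_ne_of_ne (a := σ a) (b := u)]
    · simp
    · intro h; rw [h] at h2; exact h2 h1
    · rintro h; rw [h] at h2; exact h2 hu

theorem wsat_lower_bound_via_gamma {α : Type*} [DecidableEq α]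
    (r s n : ℕ) (hr : 2 ≤ r) (hs : 2 ≤ s)
    (H : Finset (Finset α)) (hne : H.Nonempty)
    (hunif : ∀ e ∈ H, e.card = r)
    (hsp : spars H = s)
    (hn : (H.sup id).card ≤ n) :
    gammaVal s H * ((n.choose (s - 1) : ℝ) - (hyperShadow (s - 1) H).card) +
        (H.card : ℝ) - 1 ≤ wsatNum r n H := by
  classical
  -- the weak saturation number is attained
  have hmem : wsatNum r n H ∈ {m | ∃ F : Finset (Finset (Fin n)),
      (∀ e ∈ F, e.card = r) ∧ WSat r H F ∧ F.card = m} := by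
    apply Nat.sInf_mem
    refine ⟨_, powersetCard r univ, ?_, ⟨[], List.nodup_nil, ?_, ?_⟩, rfl⟩
    · intro e he; exact (mem_powersetCard.1 he).2
    · intro e; simp [mem_powersetCard]
    · intro i; exact i.elim0
  obtain ⟨F, hFr, ⟨l, hnd, hl, hcopy⟩, hFc⟩ := hmem
  rw [← hFc]
  set γ := gammaVal s H with hγdef
  have hγ : 0 ≤ γ := gamma_nonneg s H
  set a := (hyperShadow (s - 1) H).card with ha
  -- phase 1
  have phase1 : ∀ i ≤ l.length, ∃ P, GoodFam γ (s - 1) a H.card F P ∧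
      ∀ x ∈ l.take i, ∃ C ∈ P, x ∈ C := by
    intro i
    induction i with
    | zero => intro _; exact ⟨∅, ⟨by simp, by simp⟩, by simp⟩
    | succ i ih =>
      intro hi
      obtain ⟨P, hP, hcov⟩ := ih (by omega)
      obtain ⟨f, hf, d, hd, hfd⟩ := hcopy ⟨i, hi⟩
      have hC : IsC H (H.image fun d => d.image f) := ⟨f, f.injective.injOn, rfl⟩
      obtain ⟨p1, p2, p3⟩ := hC.props s
      have htake : l.take (i + 1) = l.take i ++ [l.get ⟨i, hi⟩] := by
        simp
      obtain ⟨P', hP', hold, C', hC', hKC⟩ := step hγ hP p1 p2 p3 (l.get ⟨i, hi⟩) (by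
        intro x hx
        obtain ⟨d, hd, rfl⟩ := mem_image.1 hx
        have := hf d hd
        simp only [htake, mem_union, List.mem_toFinset, List.mem_append, List.mem_singleton] at this
        rcases this with h | h | h
        · exact Or.inl h
        · exact Or.inr (Or.inr (hcov _ h))
        · exact Or.inr (Or.inl h))
      refine ⟨P', hP', ?_⟩
      intro x hx
      rw [htake] at hx
      rcases List.mem_append.1 hx with hx | hx
      · obtain ⟨C, hC, hxC⟩ := hcov x hx
        obtain ⟨C'', h1, h2⟩ := hold C hC
        exact ⟨C'', h1, h2 hxC⟩
      · rw [List.mem_singleton] at hx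
        refine ⟨C', hC', hKC ?_⟩
        rw [hx, ← hfd]
        exact mem_image_of_mem (fun d => d.image f) hd
  obtain ⟨P1, hP1, hcov1⟩ := phase1 l.length le_rfl
  rw [List.take_length] at hcov1
  -- phase 2
  have phase2 : ∀ Q : Finset (Finset (Finset (Fin n))), (∀ K ∈ Q, IsC H K) →
      ∃ P, GoodFam γ (s - 1) a H.card F P ∧ (∀ x ∈ l, ∃ C ∈ P, x ∈ C) ∧
      ∀ K ∈ Q, ∃ C ∈ P, K ⊆ C := by
    intro Q
    induction Q using Finset.induction_on with
    | empty => intro _; exact ⟨P1, hP1, hcov1, by simp⟩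
    | insert K Q hKQ ih =>
      intro hQ
      obtain ⟨P, hP, hcov, hall⟩ := ih (fun K hK => hQ K (mem_insert_of_mem hK))
      have hK := hQ K (mem_insert_self _ _)
      obtain ⟨p1, p2, p3⟩ := hK.props s
      obtain ⟨P', hP', hold, hnew⟩ := step hγ hP p1 p2 p3 ∅ (by
        intro x hx
        by_cases hxF : x ∈ F
        · exact Or.inl hxF
        · refine Or.inr (Or.inr (hcov x ((hl x).2 ⟨?_, hxF⟩)))
          obtain ⟨g, hg, rfl⟩ := hK
          obtain ⟨d, hd, rfl⟩ := mem_image.1 hx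
          rw [card_image_of_injOn (hg.mono (by exact_mod_cast sub_V hd)), hunif d hd])
      refine ⟨P', hP', ?_, ?_⟩
      · intro x hx
        obtain ⟨C, hC, hxC⟩ := hcov x hx
        obtain ⟨C', h1, h2⟩ := hold C hC
        exact ⟨C', h1, h2 hxC⟩
      · intro L hL
        rcases mem_insert.1 hL with rfl | hL
        · exact hnew
        · obtain ⟨C, hC, hxC⟩ := hall L hL
          obtain ⟨C', h1, h2⟩ := hold C hC
          exact ⟨C', h1, hxC.trans h2⟩
  obtain ⟨P, hP, -, hall⟩ := phase2 (univ.filter fun K => IsC H K)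
    (fun K hK => (mem_filter.1 hK).2)
  replace hall : ∀ K, IsC H K → ∃ C ∈ P, K ⊆ C := fun K hK => hall K (by simp [hK])
  have huniq : ∀ C ∈ P, ∀ D ∈ P, ∀ x, x ∈ C → x ∈ D → C = D := by
    intro C hC D hD x hxC hxD
    by_contra hne
    exact disjoint_left.1 (hP.1 C hC D hD hne) hxC hxD
  -- structure of H
  obtain ⟨d, hd⟩ := hne
  have hsr : s ≤ r := by
    rw [← hsp]
    apply Nat.sInf_le
    refine ⟨d, hunif d hd, ?_⟩
    rw [card_eq_one]
    refine ⟨d, ?_⟩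
    ext x
    simp only [mem_filter, mem_singleton]
    constructor
    · rintro ⟨hx, hdx⟩
      exact (eq_of_subset_of_card_le hdx (by rw [hunif x hx, hunif d hd])).symm
    · rintro rfl; exact ⟨hd, Subset.refl _⟩
  obtain ⟨p, hp⟩ : d.Nonempty := card_pos.1 (by rw [hunif d hd]; omega)
  obtain ⟨d', hd', hpd', hdd'⟩ : ∃ d' ∈ H, p ∈ d' ∧ d' ≠ d := by
    by_contra hcon
    push Not at hcon
    have : spars H ≤ 1 := by
      apply Nat.sInf_le
      refine ⟨{p}, card_singleton p, ?_⟩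
      rw [card_eq_one]
      refine ⟨d, ?_⟩
      ext x
      simp only [mem_filter, mem_singleton, singleton_subset_iff]
      constructor
      · rintro ⟨hx, hdx⟩
        exact hcon x hx hdx
      · rintro rfl; exact ⟨hd, hp⟩
    omega
  obtain ⟨q, hq, hqd⟩ : ∃ q ∈ d', q ∉ d := by
    by_contra hcon
    push Not at hcon
    exact hdd' (eq_of_subset_of_card_le hcon (by rw [hunif d hd, hunif d' hd']))
  -- a base injection
  obtain ⟨g, hg⟩ : ∃ g : α → Fin n, Set.InjOn g (H.sup id : Finset α) := by
    have hn0 : 0 < n := by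
      have := card_le_card (sub_V hd)
      rw [hunif d hd] at this
      omega
    haveI : Nonempty (Fin n) := ⟨⟨0, hn0⟩⟩
    obtain ⟨T, hT⟩ : ∃ T : Finset (Fin n), T.card = (H.sup id).card := by
      obtain ⟨T, -, hT⟩ := exists_subset_card_eq (s := (univ : Finset (Fin n)))
        (n := (H.sup id).card) (by simpa using hn)
      exact ⟨T, hT⟩
    let e := Finset.equivOfCardEq hT.symm
    refine ⟨fun x => if h : x ∈ H.sup id then (e ⟨x, h⟩ : Fin n) else Classical.arbitrary _, ?_⟩
    intro x hx y hy hxy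
    have hx' : x ∈ H.sup id := hx
    have hy' : y ∈ H.sup id := hy
    simp only [hx', hy', dif_pos] at hxy
    have := e.injective (Subtype.ext hxy)
    simpa using this
  have hcomp : ∀ σ : Equiv.Perm (Fin n), Set.InjOn (σ ∘ g) (H.sup id : Finset α) :=
    fun σ => σ.injective.comp_injOn hg
  -- linking
  have link0 : ∀ C ∈ P, ∀ e ∈ C, e.card = r → ∀ u v, u ∈ e → v ∉ e →
      e.image (Equiv.swap u v) ∈ C := by
    intro C hC e heC her u v hu hv
    have hgd : (d.image g).card = e.card := by
      rw [card_image_of_injOn (hg.mono (by exact_mod_cast sub_V hd)), hunif d hd, her]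
    obtain ⟨σ, hσ, hσp, hσq⟩ := exists_perm_image2 (a := g p) (b := g q) hgd
      (mem_image_of_mem g hp) (by
        intro h
        obtain ⟨t, ht, htq⟩ := mem_image.1 h
        have := hg (sub_V hd ht) (sub_V hd' hq) htq
        exact hqd (this ▸ ht)) hu hv
    obtain ⟨C1, hC1, hK1⟩ := hall _ ⟨σ ∘ g, hcomp σ, rfl⟩
    obtain ⟨C2, hC2, hK2⟩ := hall _ ⟨(Equiv.swap u v * σ : Equiv.Perm (Fin n)) ∘ g, hcomp _, rfl⟩
    have him : ∀ x : Finset α, x.image ((Equiv.swap u v * σ : Equiv.Perm (Fin n)) ∘ g)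
        = (x.image (σ ∘ g)).image (Equiv.swap u v) := by
      intro x; rw [image_image]; rfl
    have hde : d.image (σ ∘ g) = e := by rw [← image_image, hσ]
    have m1 : e ∈ C1 := hK1 (mem_image.2 ⟨d, hd, hde⟩)
    have m2 : d'.image (σ ∘ g) ∈ C1 := hK1 (mem_image.2 ⟨d', hd', rfl⟩)
    have m3 : e.image (Equiv.swap u v) ∈ C2 :=
      hK2 (mem_image.2 ⟨d, hd, by simp only [him, hde]⟩)
    have m4 : d'.image (σ ∘ g) ∈ C2 := by
      refine hK2 (mem_image.2 ⟨d', hd', ?_⟩)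
      simp only [him]
      apply swap_image_of_iff
      have t1 : u ∈ d'.image (σ ∘ g) := mem_image.2 ⟨p, hpd', hσp⟩
      have t2 : v ∈ d'.image (σ ∘ g) := mem_image.2 ⟨q, hq, hσq⟩
      tauto
    rw [huniq C hC C1 hC1 e heC m1, huniq C1 hC1 C2 hC2 _ m2 m4]
    exact m3
  have link : ∀ C ∈ P, ∀ e ∈ C, e.card = r → ∀ u v, e.image (Equiv.swap u v) ∈ C := by
    intro C hC e heC her u v
    by_cases hu : u ∈ e <;> by_cases hv : v ∈ e
    · rw [swap_image_of_iff (by tauto)]; exact heC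
    · exact link0 C hC e heC her u v hu hv
    · rw [Equiv.swap_comm]; exact link0 C hC e heC her v u hv hu
    · rw [swap_image_of_iff (by tauto)]; exact heC
  obtain ⟨C, hC, hKC⟩ := hall _ ⟨g, hg, rfl⟩
  have he0 : d.image g ∈ C := hKC (mem_image.2 ⟨d, hd, rfl⟩)
  have he0r : (d.image g).card = r := by
    rw [card_image_of_injOn (hg.mono (by exact_mod_cast sub_V hd)), hunif d hd]
  have hperm : ∀ σ : Equiv.Perm (Fin n), (d.image g).image σ ∈ C := by
    intro σ
    induction σ using Equiv.Perm.swap_induction_on with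
    | one => simpa using he0
    | swap_mul f x y hxy ih =>
      have := link C hC _ ih (by rw [card_image_of_injective _ f.injective, he0r]) x y
      rw [image_image] at this
      exact this
  have hCall : ∀ e : Finset (Fin n), e.card = r → e ∈ C := by
    intro e he
    obtain ⟨σ, rfl⟩ := exists_perm_image (he0r.trans he.symm)
    exact hperm σ
  have hrn : r ≤ n := by
    have := card_le_univ (d.image g)
    simpa [he0r] using this
  have hsh : n.choose (s - 1) ≤ (hyperShadow (s - 1) C).card := by
    have : (powersetCard (s - 1) (univ : Finset (Fin n))).card = n.choose (s - 1) := by simp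
    rw [← this]
    apply card_le_card
    intro x hx
    have hxc := (mem_powersetCard.1 hx).2
    obtain ⟨y, hxy, hy⟩ := exists_superset_card_eq (s := x) (n := r) (by omega) (by simpa using hrn)
    exact mem_hs.2 ⟨y, hCall y hy, hxy, hxc⟩
  have h1 := hP.2 C hC
  have h2 : ((C ∩ F).card : ℝ) ≤ F.card := by exact_mod_cast card_le_card inter_subset_right
  have h3 : (n.choose (s - 1) : ℝ) ≤ (hyperShadow (s - 1) C).card := by exact_mod_cast hsh
  have h4 := mul_le_mul_of_nonneg_left (sub_le_sub_right h3 (a : ℝ)) hγ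
  linarith
end
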